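/- arXiv:2605.07115 — 4 statements merged into one kernel-verified Lean document; each statement's English description precedes it below -/
import Mathlib

section
/- Let A and M be two arms with means μ_A, μ_M ∈ ℝ and standard deviations σ_A, σ_M ≥ 0, let a > 0, and set δ_μ = μ_M − μ_A and δ_σ = σ_A − σ_M. Assume 0 < δ_μ < a δ_σ. Then sup_{κ∈[0,a]} D_A(κ) < sup_{κ∈[0,a]} D_M(κ) if and only if 2 δ_μ < a δ_σ. -/
/-- comparison of the worst-case leading coefficients. -/
theorem stmt_4
    (μA μM σA σM : ℝ) (hσA : 0 ≤ σA) (hσM : 0 ≤ σM)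
    (a : ℝ) (ha : 0 < a)
    (δμ δσ : ℝ) (hδμ : δμ = μM - μA) (hδσ : δσ = σA - σM)
    (hδμpos : 0 < δμ) (hδμlt : δμ < a * δσ)
    (vA vM vstar DA DM : ℝ → ℝ)
    (hvA : ∀ κ, vA κ = μA + κ * σA)
    (hvM : ∀ κ, vM κ = μM + κ * σM)
    (hvstar : ∀ κ, vstar κ = max (vA κ) (vM κ))
    (hDA : ∀ κ, DA κ = vstar κ - vA κ)
    (hDM : ∀ κ, DM κ = vstar κ - vM κ) :
    sSup (DA '' Set.Icc 0 a) < sSup (DM '' Set.Icc 0 a) ↔ 2 * δμ < a * δσ := by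
  have hs : 0 < δσ := by
    by_contra h
    nlinarith
  have h1 : IsGreatest (DA '' Set.Icc 0 a) δμ := by
    refine ⟨⟨0, ⟨le_refl _, ha.le⟩, ?_⟩, ?_⟩
    · rw [hDA, hvstar, hvA, hvM, max_eq_right (by linarith)]
      linarith
    · rintro _ ⟨k, ⟨hk0, hka⟩, rfl⟩
      have hk : 0 ≤ k * δσ := mul_nonneg hk0 hs.le
      rw [hδσ] at hk
      rw [hDA, hvstar, hvA, hvM, sub_le_iff_le_add]
      apply max_le <;> nlinarith
  have h2 : IsGreatest (DM '' Set.Icc 0 a) (a * δσ - δμ) := by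
    refine ⟨⟨a, ⟨ha.le, le_refl _⟩, ?_⟩, ?_⟩
    · rw [hDM, hvstar, hvA, hvM, max_eq_left (by subst hδσ; nlinarith)]
      subst hδσ hδμ
      ring
    · rintro _ ⟨k, ⟨hk0, hka⟩, rfl⟩
      have hk : k * δσ ≤ a * δσ := mul_le_mul_of_nonneg_right hka hs.le
      rw [hDM, hvstar, hvA, hvM, sub_le_iff_le_add]
      subst hδσ
      apply max_le <;> nlinarith
  rw [h1.csSup_eq, h2.csSup_eq]
  constructor <;> intro h <;> linarith
end

section
/- Let A and M be two arms with means μ_A, μ_M ∈ ℝ and standard deviations σ_A, σ_M ≥ 0, let a > 0, and set δ_μ = μ_M − μ_A and δ_σ = σ_A − σ_M. Assume 0 < δ_μ < a δ_σ. Then (1/a) ∫_0^a D_A(κ) dκ = δ_μ² / (2 a δ_σ) and (1/a) ∫_0^a D_M(κ) dκ = (a δ_σ − δ_μ)² / (2 a δ_σ). -/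
open intervalIntegral

theorem lin_integral_aux (p q x y : ℝ) :
    (∫ κ in x..y, (p + q * κ)) = p * (y - x) + q * ((y ^ 2 - x ^ 2) / 2) := by
  rw [intervalIntegral.integral_add (by simp) (Continuous.intervalIntegrable (by fun_prop) _ _),
    intervalIntegral.integral_const, intervalIntegral.integral_const_mul, integral_id, smul_eq_mul]
  ring

/-- averaged gaps of the two-arm gap functions over `[0, a]`. -/
theorem stmt_5
    (μA μM σA σM : ℝ) (hσA : 0 ≤ σA) (hσM : 0 ≤ σM)
    (a : ℝ) (ha : 0 < a)
    (δμ δσ : ℝ) (hδμ : δμ = μM - μA) (hδσ : δσ = σA - σM)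
    (hδμpos : 0 < δμ) (hδμlt : δμ < a * δσ)
    (vA vM vstar DA DM : ℝ → ℝ)
    (hvA : ∀ κ, vA κ = μA + κ * σA)
    (hvM : ∀ κ, vM κ = μM + κ * σM)
    (hvstar : ∀ κ, vstar κ = max (vA κ) (vM κ))
    (hDA : ∀ κ, DA κ = vstar κ - vA κ)
    (hDM : ∀ κ, DM κ = vstar κ - vM κ) :
    (1 / a) * (∫ κ in (0 : ℝ)..a, DA κ) = δμ ^ 2 / (2 * a * δσ) ∧
    (1 / a) * (∫ κ in (0 : ℝ)..a, DM κ) = (a * δσ - δμ) ^ 2 / (2 * a * δσ) := by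
  have hs : 0 < δσ := by
    by_contra h
    nlinarith
  have hcA : Continuous DA := by
    have : DA = fun κ => max (μA + κ * σA) (μM + κ * σM) - (μA + κ * σA) := by
      funext κ
      rw [hDA, hvstar, hvA, hvM]
    rw [this]
    fun_prop
  have hcM : Continuous DM := by
    have : DM = fun κ => max (μA + κ * σA) (μM + κ * σM) - (μM + κ * σM) := by
      funext κ
      rw [hDM, hvstar, hvA, hvM]
    rw [this]
    fun_prop
  obtain ⟨c, hc⟩ : ∃ c, c = δμ / δσ := ⟨_, rfl⟩
  have hcs : c * δσ = δμ := by rw [hc]; field_simp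
  have hc0 : 0 ≤ c := by rw [hc]; positivity
  have hca : c ≤ a := by
    rw [hc, div_le_iff₀ hs]; exact hδμlt.le
  have low : ∀ κ ∈ Set.uIcc 0 c, max (vA κ) (vM κ) = vM κ := by
    intro κ hκ
    rw [Set.uIcc_of_le hc0] at hκ
    apply max_eq_right
    rw [hvA, hvM]
    nlinarith [mul_le_mul_of_nonneg_right hκ.2 hs.le]
  have high : ∀ κ ∈ Set.uIcc c a, max (vA κ) (vM κ) = vA κ := by
    intro κ hκ
    rw [Set.uIcc_of_le hca] at hκ
    apply max_eq_left
    rw [hvA, hvM]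
    nlinarith [mul_le_mul_of_nonneg_right hκ.1 hs.le]
  have A1 : (∫ κ in (0 : ℝ)..c, DA κ) = ∫ κ in (0 : ℝ)..c, (δμ + (-δσ) * κ) := by
    apply intervalIntegral.integral_congr
    intro κ hκ
    simp only [hDA, hvstar, low κ hκ]
    rw [hvA, hvM, hδμ, hδσ]; ring
  have A2 : (∫ κ in c..a, DA κ) = ∫ κ in c..a, ((0 : ℝ) + 0 * κ) := by
    apply intervalIntegral.integral_congr
    intro κ hκ
    simp only [hDA, hvstar, high κ hκ]
    ring
  have M1 : (∫ κ in (0 : ℝ)..c, DM κ) = ∫ κ in (0 : ℝ)..c, ((0 : ℝ) + 0 * κ) := by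
    apply intervalIntegral.integral_congr
    intro κ hκ
    simp only [hDM, hvstar, low κ hκ]
    ring
  have M2 : (∫ κ in c..a, DM κ) = ∫ κ in c..a, (-δμ + δσ * κ) := by
    apply intervalIntegral.integral_congr
    intro κ hκ
    simp only [hDM, hvstar, high κ hκ]
    rw [hvA, hvM, hδμ, hδσ]; ring
  constructor
  · rw [← intervalIntegral.integral_add_adjacent_intervals (hcA.intervalIntegrable 0 c)
      (hcA.intervalIntegrable c a), A1, A2, lin_integral_aux, lin_integral_aux, ← hcs]
    field_simp
    ring
  · rw [← intervalIntegral.integral_add_adjacent_intervals (hcM.intervalIntegrable 0 c)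
      (hcM.intervalIntegrable c a), M1, M2, lin_integral_aux, lin_integral_aux, ← hcs]
    field_simp
    ring
end

section
/- Let Y be a real random variable with the Gaussian distribution N(μ, σ²), σ > 0, let a > 0, set q_low = μ − σa, q_high = μ + σa, and S = max{q_low − Y, Y − q_high}. Let β ∈ (0,1) and let z_β ∈ ℝ satisfy Φ(z_β) = 1 − β/2, where Φ is the CDF of N(0,1). Then z_β ≥ 0 and P(S ≤ σ(z_β − a)) = 1 − β; consequently q_low − σ(z_β − a) = μ − σ z_β and q_high + σ(z_β − a) = μ + σ z_β. -/
open MeasureTheory ProbabilityTheory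

/-- the Gaussian score-quantile identity. For `Y ~ N(μ, σ²)`,
`q_low = μ - σa`, `q_high = μ + σa`, score `S = max (q_low - Y) (Y - q_high)`,
and `z_β` with `Φ(z_β) = 1 - β/2` (`Φ` the standard Gaussian CDF), one has
`z_β ≥ 0`, `P(S ≤ σ(z_β - a)) = 1 - β`, and the corrected interval endpoints
are `μ ∓ σ z_β`. -/
theorem stmt_15
    {Ω : Type*} [MeasurableSpace Ω] (P : Measure Ω) [IsProbabilityMeasure P]
    (μ σ : ℝ) (hσ : 0 < σ) (a : ℝ) (ha : 0 < a)
    (Y : Ω → ℝ) (hY : Measurable Y)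
    (hdist : P.map Y = gaussianReal μ ⟨σ ^ 2, sq_nonneg σ⟩)
    (qlow qhigh : ℝ) (hql : qlow = μ - σ * a) (hqh : qhigh = μ + σ * a)
    (S : Ω → ℝ) (hS : ∀ ω, S ω = max (qlow - Y ω) (Y ω - qhigh))
    (Φ : ℝ → ℝ) (hΦ : ∀ t : ℝ, Φ t = ((gaussianReal 0 1) (Set.Iic t)).toReal)
    (β : ℝ) (hβ : β ∈ Set.Ioo (0 : ℝ) 1)
    (zβ : ℝ) (hzβ : Φ zβ = 1 - β / 2) :
    0 ≤ zβ ∧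
    (P {ω | S ω ≤ σ * (zβ - a)}).toReal = 1 - β ∧
    qlow - σ * (zβ - a) = μ - σ * zβ ∧
    qhigh + σ * (zβ - a) = μ + σ * zβ := by
  obtain ⟨hβ0, hβ1⟩ := hβ
  rw [hΦ] at hzβ
  change (gaussianReal 0 1).real (Set.Iic zβ) = 1 - β / 2 at hzβ
  have hneg : (gaussianReal 0 1).map (fun x : ℝ => -x) = gaussianReal 0 1 := by
    rw [gaussianReal_map_neg, neg_zero]
  have hsymm : ∀ s : Set ℝ, MeasurableSet s →
      (gaussianReal 0 1).real ((fun x : ℝ => -x) ⁻¹' s) = (gaussianReal 0 1).real s := by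
    intro s hs
    conv_rhs => rw [← hneg]
    rw [map_measureReal_apply measurable_neg hs]
  have hz : 0 ≤ zβ := by
    by_contra hlt
    push Not at hlt
    have h1 := hsymm (Set.Iic zβ) measurableSet_Iic
    have hd : Disjoint (Set.Iic zβ) ((fun x : ℝ => -x) ⁻¹' (Set.Iic zβ)) := by
      rw [Set.disjoint_left]
      intro x hx hx'
      simp only [Set.mem_preimage, Set.mem_Iic] at hx hx'
      linarith
    have h2 := measureReal_union (μ := gaussianReal 0 1) hd (measurable_neg measurableSet_Iic)
    have h3 : (gaussianReal 0 1).real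
      (Set.Iic zβ ∪ ((fun x : ℝ => -x) ⁻¹' (Set.Iic zβ))) ≤ 1 := measureReal_le_one
    linarith
  have hIoi : (gaussianReal 0 1).real (Set.Ioi zβ) = β / 2 := by
    rw [← Set.compl_Iic, probReal_compl_eq_one_sub measurableSet_Iic, hzβ]
    ring
  have hIio : (gaussianReal 0 1).real (Set.Iio (-zβ)) = β / 2 := by
    rw [← hIoi, ← hsymm (Set.Ioi zβ) measurableSet_Ioi]
    congr 1
    ext x
    simp only [Set.mem_preimage, Set.mem_Iio, Set.mem_Ioi]
    constructor <;> intro h <;> linarith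
  have hIcc : (gaussianReal 0 1).real (Set.Icc (-zβ) zβ) = 1 - β := by
    have he : Set.Icc (-zβ) zβ = Set.Iic zβ \ Set.Iio (-zβ) := by
      ext x
      simp only [Set.mem_Icc, Set.mem_sdiff, Set.mem_Iic, Set.mem_Iio, not_lt]
      tauto
    have hsub : Set.Iio (-zβ) ⊆ Set.Iic zβ := by
      intro x hx
      simp only [Set.mem_Iic, Set.mem_Iio] at hx ⊢
      linarith
    rw [he, measureReal_sdiff hsub measurableSet_Iio, hzβ, hIio]
    ring
  have hmap : (gaussianReal 0 1).map (fun x : ℝ => σ * x + μ)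
      = gaussianReal μ ⟨σ ^ 2, sq_nonneg σ⟩ := by
    have h : (fun x : ℝ => σ * x + μ) = (fun x => x + μ) ∘ (fun x => σ * x) := rfl
    rw [h, ← Measure.map_map (by fun_prop) (by fun_prop), gaussianReal_map_const_mul,
      gaussianReal_map_add_const]
    simp
    rfl
  refine ⟨hz, ?_, by rw [hql]; ring, by rw [hqh]; ring⟩
  have hev : {ω | S ω ≤ σ * (zβ - a)} = Y ⁻¹' (Set.Icc (μ - σ * zβ) (μ + σ * zβ)) := by
    ext ω
    simp only [Set.mem_ofPred_eq, Set.mem_preimage, Set.mem_Icc, hS, max_le_iff, hql, hqh]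
    constructor <;> rintro ⟨h1, h2⟩ <;> constructor <;> linarith
  rw [hev, ← Measure.map_apply hY measurableSet_Icc, hdist, ← hmap,
    Measure.map_apply (by fun_prop) measurableSet_Icc, ← hIcc, Measure.real]
  congr 2
  ext x
  simp only [Set.mem_preimage, Set.mem_Icc]
  constructor
  · rintro ⟨h1, h2⟩
    constructor <;> refine le_of_mul_le_mul_left ?_ hσ <;> linarith
  · rintro ⟨h1, h2⟩
    constructor <;> nlinarith
end

section
/- Let Y be a real random variable with the Gaussian distribution N(μ, σ²), σ > 0, let a > 0, set q_low = μ − σa, q_high = μ + σa, and S = max{q_low − Y, Y − q_high}. Then the function z ↦ P(S ≤ z) is differentiable at every z > −σa with derivative (2/σ) φ(a + z/σ), where φ(t) = (1/√(2π)) exp(−t²/2) is the standard Gaussian density. -/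
open MeasureTheory ProbabilityTheory

/-- the Gaussian score density. For `Y ~ N(μ, σ²)`,
`q_low = μ - σa`, `q_high = μ + σa`, and score `S = max (q_low - Y) (Y - q_high)`,
the score CDF `z ↦ P(S ≤ z)` is differentiable at every `z > -σa` with
derivative `(2/σ) φ(a + z/σ)`, where `φ` is the standard Gaussian density. -/
theorem stmt_16
    {Ω : Type*} [MeasurableSpace Ω] (P : Measure Ω) [IsProbabilityMeasure P]
    (μ σ : ℝ) (hσ : 0 < σ) (a : ℝ) (ha : 0 < a)
    (Y : Ω → ℝ) (hY : Measurable Y)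
    (hdist : P.map Y = gaussianReal μ ⟨σ ^ 2, sq_nonneg σ⟩)
    (qlow qhigh : ℝ) (hql : qlow = μ - σ * a) (hqh : qhigh = μ + σ * a)
    (S : Ω → ℝ) (hS : ∀ ω, S ω = max (qlow - Y ω) (Y ω - qhigh))
    (φ : ℝ → ℝ)
    (hφ : ∀ t : ℝ, φ t = (1 / Real.sqrt (2 * Real.pi)) * Real.exp (-t ^ 2 / 2)) :
    ∀ z : ℝ, -(σ * a) < z →
      HasDerivAt (fun t : ℝ => (P {ω | S ω ≤ t}).toReal)
        ((2 / σ) * φ (a + z / σ)) z := by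
  intro z hz
  set v : NNReal := ⟨σ ^ 2, sq_nonneg σ⟩ with hv
  have hvc : (v : ℝ) = σ ^ 2 := rfl
  have hv0 : v ≠ 0 := by
    intro h
    have h2 : (v : ℝ) = 0 := by rw [h]; rfl
    rw [hvc] at h2
    exact (pow_pos hσ 2).ne' h2
  have hcont : Continuous (gaussianPDFReal μ v) := by
    rw [gaussianPDFReal_def]
    fun_prop
  have hpdf : ∀ x : ℝ, (x - μ) ^ 2 = (σ * a + z) ^ 2 →
      gaussianPDFReal μ v x = (1 / σ) * φ (a + z / σ) := by
    intro x hx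
    have e1 : Real.sqrt (2 * Real.pi * σ ^ 2) = Real.sqrt (2 * Real.pi) * σ := by
      rw [Real.sqrt_mul (by positivity), Real.sqrt_sq hσ.le]
    have e2 : -(σ * a + z) ^ 2 / (2 * σ ^ 2) = -(a + z / σ) ^ 2 / 2 := by
      field_simp
    rw [hφ, gaussianPDFReal, hvc, hx, e1, e2, mul_inv]
    ring
  have hF : ∀ x : ℝ, HasDerivAt (fun u => ∫ y in μ..u, gaussianPDFReal μ v y)
      (gaussianPDFReal μ v x) x := fun x =>
    intervalIntegral.integral_hasDerivAt_right (hcont.intervalIntegrable _ _)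
      (hcont.stronglyMeasurableAtFilter _ _) hcont.continuousAt
  have h1 : HasDerivAt (fun t : ℝ => qhigh + t) 1 z := (hasDerivAt_id z).const_add qhigh
  have h2 : HasDerivAt (fun t : ℝ => qlow - t) (-1) z := (hasDerivAt_id z).const_sub qlow
  have h3 := ((hF (qhigh + z)).comp z h1).sub ((hF (qlow - z)).comp z h2)
  have hd : gaussianPDFReal μ v (qhigh + z) * 1 - gaussianPDFReal μ v (qlow - z) * (-1)
      = (2 / σ) * φ (a + z / σ) := by
    rw [hpdf (qhigh + z) (by rw [hqh]; ring), hpdf (qlow - z) (by rw [hql]; ring)]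
    ring
  rw [hd] at h3
  refine h3.congr_of_eventuallyEq ?_
  filter_upwards [lt_mem_nhds hz] with t ht
  have hle : qlow - t ≤ qhigh + t := by rw [hql, hqh]; linarith
  have hset : {ω | S ω ≤ t} = Y ⁻¹' (Set.Icc (qlow - t) (qhigh + t)) := by
    ext ω
    simp only [Set.mem_ofPred_eq, hS, max_le_iff, Set.mem_preimage, Set.mem_Icc]
    constructor <;> rintro ⟨h, h'⟩ <;> constructor <;> linarith
  rw [hset, ← Measure.map_apply hY measurableSet_Icc, hdist,
    gaussianReal_apply_eq_integral μ hv0,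
    ENNReal.toReal_ofReal (integral_nonneg fun x => gaussianPDFReal_nonneg μ v x),
    integral_Icc_eq_integral_Ioc, ← intervalIntegral.integral_of_le hle]
  exact (intervalIntegral.integral_interval_sub_left
    (hcont.intervalIntegrable _ _) (hcont.intervalIntegrable _ _)).symm
end
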